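/- arXiv:1010.5810 — 12 statements merged into one kernel-verified Lean document; each statement's English description precedes it below -/
import Mathlib

section
/- Let P₁ and P₂ be equivalent probability measures on a measurable space (Ω, 𝓕) and let φ = dP₂/dP₁ be the Radon–Nikodym derivative. Let α ∈ [0,1] and suppose there exists a constant c ≥ 0 such that P₁({φ ≤ c}) = 1 − α. Then the set B̃ = {φ ≤ c} satisfies P₁(B̃) ≥ 1 − α, and for every measurable set B with P₁(B) ≥ 1 − α one has P₂(B) ≥ P₂(B̃); that is, B̃ minimizes P₂(B) among all measurable B with P₁(B) ≥ 1 − α. -/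
open MeasureTheory Filter Topology Set

/-- **Neyman–Pearson**: a sublevel set of a density minimizes the integral of that density among
all measurable sets of at least the same measure. -/
theorem setLIntegral_sublevel_le_of_measure_le {Ω : Type*} [MeasurableSpace Ω]
    {μ : Measure Ω} [IsFiniteMeasure μ] {f : Ω → ENNReal} {c : ENNReal} {T B : Set Ω}
    (hT : MeasurableSet T) (hB : MeasurableSet B)
    (hfT : ∀ ω ∈ T, f ω ≤ c) (hfTc : ∀ ω ∉ T, c ≤ f ω) (hTB : μ T ≤ μ B) :
    ∫⁻ ω in T, f ω ∂μ ≤ ∫⁻ ω in B, f ω ∂μ := by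
  have hdiff : μ (T \ B) ≤ μ (B \ T) := by
    rw [← measure_inter_add_sdiff T hB, ← measure_inter_add_sdiff B hT, inter_comm B T] at hTB
    exact (ENNReal.add_le_add_iff_left (measure_ne_top μ _)).1 hTB
  rw [← lintegral_inter_add_sdiff f T hB, ← lintegral_inter_add_sdiff f B hT, inter_comm B T]
  refine add_le_add_right ?_ _
  calc ∫⁻ ω in T \ B, f ω ∂μ ≤ ∫⁻ _ in T \ B, c ∂μ :=
        setLIntegral_mono' (hT.diff hB) fun ω hω => hfT ω hω.1
    _ = c * μ (T \ B) := setLIntegral_const _ _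
    _ ≤ c * μ (B \ T) := by gcongr
    _ = ∫⁻ _ in B \ T, c ∂μ := (setLIntegral_const _ _).symm
    _ ≤ ∫⁻ ω in B \ T, f ω ∂μ :=
        setLIntegral_mono' (hB.diff hT) fun ω hω => hfTc ω hω.2

theorem stmt0
    {Ω : Type*} [MeasurableSpace Ω]
    (P₁ P₂ : Measure Ω) [IsProbabilityMeasure P₁] [IsProbabilityMeasure P₂]
    (φ : Ω → ℝ) (hφmeas : Measurable φ) (hφpos : ∀ᵐ ω ∂P₁, 0 < φ ω)
    (hP₂ : P₂ = P₁.withDensity (fun ω => ENNReal.ofReal (φ ω)))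
    (α : ℝ) (hα0 : 0 ≤ α) (hα1 : α ≤ 1)
    (c : ℝ) (hc : 0 ≤ c)
    (hcα : (P₁ {ω | φ ω ≤ c}).toReal = 1 - α) :
    (P₁ {ω | φ ω ≤ c}).toReal ≥ 1 - α ∧
    ∀ B : Set Ω, MeasurableSet B → (P₁ B).toReal ≥ 1 - α →
      P₂ {ω | φ ω ≤ c} ≤ P₂ B := by
  refine ⟨hcα.ge, fun B hB hPB => ?_⟩
  have hT : MeasurableSet {ω | φ ω ≤ c} := measurableSet_le hφmeas measurable_const
  rw [hP₂, withDensity_apply _ hT, withDensity_apply _ hB]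
  refine setLIntegral_sublevel_le_of_measure_le (c := ENNReal.ofReal c) hT hB
    (fun ω hω => ENNReal.ofReal_le_ofReal hω)
    (fun ω hω => ENNReal.ofReal_le_ofReal (not_le.1 hω).le) ?_
  rw [← ENNReal.toReal_le_toReal (measure_ne_top P₁ _) (measure_ne_top P₁ _), hcα]
  exact hPB
end

section
/- Let P and Q be equivalent probability measures on a measurable space (Ω, 𝓕) with density Λ = dP/dQ, let H : Ω → [0,∞) be measurable and Q-integrable, and let x > 0. Suppose c ≥ 0 is a constant such that the set A_c = {Λ ≥ c·H} satisfies ∫_{A_c} H dQ = x. Then for every measurable set A with ∫_A H dQ ≤ x one has P(A) ≤ P(A_c); that is, A_c maximizes P(A) among all measurable A satisfying the budget constraint ∫_A H dQ ≤ x. -/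
open MeasureTheory Filter Topology Set

theorem stmt1
    {Ω : Type*} [MeasurableSpace Ω]
    (P Q : Measure Ω) [IsProbabilityMeasure P] [IsProbabilityMeasure Q]
    (Λ : Ω → ℝ) (hΛmeas : Measurable Λ) (hΛpos : ∀ᵐ ω ∂Q, 0 < Λ ω)
    (hP : P = Q.withDensity (fun ω => ENNReal.ofReal (Λ ω)))
    (H : Ω → ℝ) (hHmeas : Measurable H) (hHnn : ∀ ω, 0 ≤ H ω)
    (hHint : Integrable H Q)
    (x : ℝ) (hx : 0 < x) (c : ℝ) (hc : 0 ≤ c)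
    (hbind : ∫ ω in {ω | c * H ω ≤ Λ ω}, H ω ∂Q = x) :
    ∀ A : Set Ω, MeasurableSet A → ∫ ω in A, H ω ∂Q ≤ x →
      P A ≤ P {ω | c * H ω ≤ Λ ω} := by
  intro A hA hAx
  have hΛnn : 0 ≤ᵐ[Q] Λ := hΛpos.mono fun ω h => h.le
  have hΛint : Integrable Λ Q := by
    refine ⟨hΛmeas.aestronglyMeasurable, ?_⟩
    rw [hasFiniteIntegral_iff_ofReal hΛnn, ← setLIntegral_univ,
      ← withDensity_apply _ MeasurableSet.univ, ← hP]
    exact measure_lt_top P univ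
  have hPeq : ∀ S : Set Ω, MeasurableSet S → P S = ENNReal.ofReal (∫ ω in S, Λ ω ∂Q) := by
    intro S hS
    rw [ofReal_integral_eq_lintegral_ofReal hΛint.integrableOn (ae_restrict_of_ae hΛnn), hP,
      withDensity_apply _ hS]
  have hB : MeasurableSet {ω | c * H ω ≤ Λ ω} :=
    measurableSet_le (hHmeas.const_mul c) hΛmeas
  have hcH : Integrable (fun ω => c * H ω) Q := hHint.const_mul c
  have key := setIntegral_le_nonneg (μ := Q) (f := fun ω => Λ ω - c * H ω) hA
    (hΛmeas.sub (hHmeas.const_mul c)).stronglyMeasurable (hΛint.sub hcH)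
  simp only [sub_nonneg] at key
  rw [integral_sub hΛint.integrableOn hcH.integrableOn,
    integral_sub hΛint.integrableOn hcH.integrableOn,
    integral_const_mul, integral_const_mul, hbind] at key
  rw [hPeq A hA, hPeq _ hB]
  apply ENNReal.ofReal_le_ofReal
  linarith [mul_le_mul_of_nonneg_left hAx hc]
end

section
/- Let P and Q be equivalent probability measures on a measurable space (Ω, 𝓕) with density Λ = dP/dQ, let H : Ω → [0,∞) be measurable and Q-integrable, and let α ∈ [0,1]. Suppose c ≥ 0 is a constant such that the set A_c = {Λ ≥ c·H} satisfies P(A_c) = 1 − α. Then for every measurable set B with P(B) ≥ 1 − α one has ∫_B H dQ ≥ ∫_{A_c} H dQ; that is, A_c minimizes the cost ∫_B H dQ among all measurable B with P(B) ≥ 1 − α. -/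
open MeasureTheory Filter Topology Set

/-- If `P` has density `Λ` with respect to `Q`, then `Λ` is `Q`-integrable. -/
theorem integrable_of_eq_withDensity_ofReal {Ω : Type*} [MeasurableSpace Ω]
    {P Q : Measure Ω} [IsFiniteMeasure P] {Λ : Ω → ℝ} (hΛmeas : Measurable Λ)
    (hΛnn : ∀ᵐ ω ∂Q, 0 ≤ Λ ω) (hP : P = Q.withDensity (fun ω => ENNReal.ofReal (Λ ω))) :
    Integrable Λ Q := by
  refine (lintegral_ofReal_ne_top_iff_integrable hΛmeas.aestronglyMeasurable hΛnn).1 ?_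
  rw [← setLIntegral_univ, ← withDensity_apply _ MeasurableSet.univ, ← hP]
  exact measure_ne_top P _

/-- If `P` has density `Λ` with respect to `Q`, then the `P`-measure of a set is the integral of
`Λ` over it. -/
theorem toReal_eq_setIntegral_of_eq_withDensity_ofReal {Ω : Type*} [MeasurableSpace Ω]
    {P Q : Measure Ω} {Λ : Ω → ℝ} (hΛmeas : Measurable Λ)
    (hΛnn : ∀ᵐ ω ∂Q, 0 ≤ Λ ω) (hP : P = Q.withDensity (fun ω => ENNReal.ofReal (Λ ω)))
    {S : Set Ω} (hS : MeasurableSet S) :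
    (P S).toReal = ∫ ω in S, Λ ω ∂Q := by
  rw [hP, withDensity_apply _ hS,
    integral_eq_lintegral_of_nonneg_ae (ae_restrict_of_ae hΛnn) hΛmeas.aestronglyMeasurable]

theorem stmt2
    {Ω : Type*} [MeasurableSpace Ω]
    (P Q : Measure Ω) [IsProbabilityMeasure P] [IsProbabilityMeasure Q]
    (Λ : Ω → ℝ) (hΛmeas : Measurable Λ) (hΛpos : ∀ᵐ ω ∂Q, 0 < Λ ω)
    (hP : P = Q.withDensity (fun ω => ENNReal.ofReal (Λ ω)))
    (H : Ω → ℝ) (hHmeas : Measurable H) (hHnn : ∀ ω, 0 ≤ H ω)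
    (hHint : Integrable H Q)
    (α : ℝ) (hα0 : 0 ≤ α) (hα1 : α ≤ 1)
    (c : ℝ) (hc : 0 ≤ c)
    (hbind : (P {ω | c * H ω ≤ Λ ω}).toReal = 1 - α) :
    ∀ B : Set Ω, MeasurableSet B → (P B).toReal ≥ 1 - α →
      ∫ ω in {ω | c * H ω ≤ Λ ω}, H ω ∂Q ≤ ∫ ω in B, H ω ∂Q := by
  intro B hB hPB
  have hΛnn : ∀ᵐ ω ∂Q, 0 ≤ Λ ω := hΛpos.mono fun _ h => h.le
  have hΛint := integrable_of_eq_withDensity_ofReal hΛmeas hΛnn hP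
  have hA : MeasurableSet {ω | c * H ω ≤ Λ ω} :=
    measurableSet_le (hHmeas.const_mul c) hΛmeas
  rcases hc.eq_or_lt with rfl | hcpos
  · have hQP : Q ≪ P := by
      rw [hP]
      exact withDensity_absolutelyContinuous' hΛmeas.ennreal_ofReal.aemeasurable
        (hΛpos.mono fun _ h => (ENNReal.ofReal_pos.2 h).ne')
    have hPQ : P ≪ Q := hP ▸ withDensity_absolutelyContinuous Q _
    have hA1 : P {ω | 0 * H ω ≤ Λ ω} = 1 := by
      refine (prob_compl_eq_zero_iff hA).1 (hPQ (ae_iff.1 ?_))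
      simpa using hΛnn
    have hB1 : P B = 1 := by
      refine le_antisymm prob_le_one ?_
      rw [hA1, ENNReal.toReal_one] at hbind
      rwa [← hbind, ge_iff_le, ← ENNReal.toReal_one,
        ENNReal.toReal_le_toReal ENNReal.one_ne_top (measure_ne_top P B)] at hPB
    have hBQ : ∀ᵐ ω ∂Q, ω ∈ B := hQP ((prob_compl_eq_zero_iff hB).2 hB1)
    rw [Measure.restrict_eq_self_of_ae_mem hBQ]
    exact setIntegral_le_integral hHint (ae_of_all _ hHnn)
  · have key : ∫ ω in B, (Λ ω - c * H ω) ∂Q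
        ≤ ∫ ω in {ω | c * H ω ≤ Λ ω}, (Λ ω - c * H ω) ∂Q := by
      simpa only [Pi.sub_apply, sub_nonneg] using setIntegral_le_nonneg hB
        (hΛmeas.sub (hHmeas.const_mul c)).stronglyMeasurable (hΛint.sub (hHint.const_mul c))
    rw [integral_sub hΛint.integrableOn (hHint.const_mul c).integrableOn,
      integral_sub hΛint.integrableOn (hHint.const_mul c).integrableOn,
      integral_const_mul, integral_const_mul,
      ← toReal_eq_setIntegral_of_eq_withDensity_ofReal hΛmeas hΛnn hP hB,
      ← toReal_eq_setIntegral_of_eq_withDensity_ofReal hΛmeas hΛnn hP hA] at key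
    refine le_of_mul_le_mul_left ?_ hcpos
    linarith
end

section
/- Assume Z·H = f∘W a.s., where the law of W under P is equivalent to d-dimensional Lebesgue measure λ_d. Then the function Ψ₁(c) = P({Z⁻¹ ≥ c·H}) is continuous on [0, ∞) if and only if condition (C1) holds, i.e. if and only if λ_d({z : f(z) = c}) = 0 for every c > 0. -/
open MeasureTheory Filter Topology Set

/-- The map `c ↦ μ {c * g ≤ 1}` is continuous on `[0, ∞)` iff the law of the nonnegative function
`g` has no atom in `(0, ∞)`. -/
theorem continuousOn_measureReal_mul_le_one_iff {α : Type*} [MeasurableSpace α] (μ : Measure α)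
    [IsFiniteMeasure μ] {g : α → ℝ} (hg : Measurable g) (hg0 : ∀ x, 0 ≤ g x) :
    ContinuousOn (fun c : ℝ => (μ {x | c * g x ≤ 1}).toReal) (Ici 0) ↔
      ∀ a : ℝ, 0 < a → μ {x | g x = a} = 0 := by
  have hle (c : ℝ) : MeasurableSet {x | c * g x ≤ 1} :=
    measurableSet_le (hg.const_mul c) measurable_const
  have hlt (c : ℝ) : MeasurableSet {x | c * g x < 1} :=
    measurableSet_lt (hg.const_mul c) measurable_const
  have htends (c : ℝ) (x : α) : Tendsto (fun b : ℝ => b * g x) (𝓝 c) (𝓝 (c * g x)) :=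
    tendsto_id.mul_const _
  constructor
  · intro h a ha
    have hc : 0 < a⁻¹ := inv_pos.2 ha
    have hcont : Tendsto (fun c : ℝ => (μ {x | c * g x ≤ 1}).toReal) (𝓝[>] a⁻¹)
        (𝓝 (μ {x | a⁻¹ * g x ≤ 1}).toReal) :=
      ((h a⁻¹ hc.le).continuousAt (Ici_mem_nhds hc)).tendsto.mono_left nhdsWithin_le_nhds
    have hright : Tendsto (fun c : ℝ => μ {x | c * g x ≤ 1}) (𝓝[>] a⁻¹)
        (𝓝 (μ {x | a⁻¹ * g x < 1})) := by
      refine tendsto_measure_of_ae_tendsto_indicator_of_isFiniteMeasure _ (hlt _) hle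
        (ae_of_all _ fun x => ?_)
      rcases lt_or_ge (a⁻¹ * g x) 1 with hx | hx
      · filter_upwards [((htends a⁻¹ x).mono_left nhdsWithin_le_nhds).eventually_lt_const hx]
          with b hb
        exact iff_of_true hb.le hx
      · filter_upwards [self_mem_nhdsWithin] with b hb
        have hgx : 0 < g x := by
          refine (hg0 x).lt_of_ne fun h0 => ?_
          rw [← h0, mul_zero] at hx
          linarith
        have : a⁻¹ * g x < b * g x := mul_lt_mul_of_pos_right hb hgx
        exact iff_of_false (not_le.2 (hx.trans_lt this)) (not_lt.2 hx)
    have heq := tendsto_nhds_unique hcont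
      ((ENNReal.tendsto_toReal (measure_ne_top _ _)).comp hright)
    rw [ENNReal.toReal_eq_toReal_iff' (measure_ne_top _ _) (measure_ne_top _ _)] at heq
    have hsub : {x | a⁻¹ * g x < 1} ⊆ {x | a⁻¹ * g x ≤ 1} :=
      fun x (hx : a⁻¹ * g x < 1) => hx.le
    have hdiff : μ ({x | a⁻¹ * g x ≤ 1} \ {x | a⁻¹ * g x < 1}) = 0 := by
      rw [measure_sdiff hsub (hlt _).nullMeasurableSet (measure_ne_top _ _), heq, tsub_self]
    refine measure_mono_null (fun x hx => ?_) hdiff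
    have : a⁻¹ * g x = 1 := by rw [show g x = a from hx, inv_mul_cancel₀ ha.ne']
    exact ⟨this.le, this.not_lt⟩
  · intro h c hc
    refine (ENNReal.tendsto_toReal (measure_ne_top _ _)).comp
      (tendsto_measure_of_ae_tendsto_indicator_of_isFiniteMeasure _ (hle c) hle ?_)
    have hne : ∀ᵐ x ∂μ, c * g x ≠ 1 := by
      rcases (mem_Ici.1 hc).eq_or_lt with rfl | hc
      · simp
      · refine measure_mono_null (fun x hx => ?_) (h c⁻¹ (inv_pos.2 hc))
        exact eq_inv_of_mul_eq_one_right (not_not.1 hx)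
    filter_upwards [hne] with x hx
    have hx' := (htends c x).mono_left (nhdsWithin_le_nhds (s := Ici 0))
    rcases hx.lt_or_gt with hx | hx
    · filter_upwards [hx'.eventually_lt_const hx] with b hb
      exact iff_of_true hb.le hx.le
    · filter_upwards [hx'.eventually_const_lt hx] with b hb
      exact iff_of_false (not_le.2 hb) (not_le.2 hx)

theorem stmt5
    {Ω : Type*} [MeasurableSpace Ω]
    (P Q : Measure Ω) [IsProbabilityMeasure P] [IsProbabilityMeasure Q]
    (Z : Ω → ℝ) (hZmeas : Measurable Z) (hZpos : ∀ᵐ ω ∂P, 0 < Z ω)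
    (hQ : Q = P.withDensity (fun ω => ENNReal.ofReal (Z ω)))
    (H : Ω → ℝ) (hHmeas : Measurable H) (hHnn : ∀ ω, 0 ≤ H ω)
    (d : ℕ) (hd : 1 ≤ d) (W : Ω → (Fin d → ℝ)) (hW : Measurable W)
    (f : (Fin d → ℝ) → ℝ) (hf : Measurable f) (hfnn : ∀ z, 0 ≤ f z)
    (hZH : ∀ᵐ ω ∂P, Z ω * H ω = f (W ω))
    (hac1 : Measure.map W P ≪ (volume : Measure (Fin d → ℝ)))
    (hac2 : (volume : Measure (Fin d → ℝ)) ≪ Measure.map W P)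
 :
    ContinuousOn (fun c : ℝ => (P {ω | c * H ω ≤ (Z ω)⁻¹}).toReal) (Set.Ici 0) ↔ (∀ c : ℝ, 0 < c → volume {z | f z = c} = 0) := by
  have hset (c : ℝ) : P {ω | c * H ω ≤ (Z ω)⁻¹} = P {ω | c * f (W ω) ≤ 1} := by
    refine measure_congr ?_
    filter_upwards [hZpos, hZH] with ω hω hω'
    refine propext ?_
    change c * H ω ≤ (Z ω)⁻¹ ↔ c * f (W ω) ≤ 1
    rw [← hω', ← one_div, le_div_iff₀ hω]
    ring_nf
  have hnull (c : ℝ) : P {ω | f (W ω) = c} = 0 ↔ volume {z | f z = c} = 0 := by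
    have : P {ω | f (W ω) = c} = Measure.map W P {z | f z = c} :=
      (Measure.map_apply hW (hf (measurableSet_singleton c))).symm
    rw [this]
    exact ⟨fun h => hac2 h, fun h => hac1 h⟩
  simp only [hset, ← hnull]
  exact continuousOn_measureReal_mul_le_one_iff P (hf.comp hW) fun ω => hfnn (W ω)
end

section
/- Assume Z·H = f∘W a.s., where the law of W under P is equivalent to d-dimensional Lebesgue measure λ_d. Then the function Ψ₁(c) = P({Z⁻¹ ≥ c·H}) is strictly decreasing on [0, ∞) if and only if condition (C2) holds, i.e. if and only if λ_d({z : a < f(z) ≤ b}) > 0 for all 0 < a < b. -/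
open MeasureTheory Filter Topology Set

/-- For nonnegative `f`, the drop of `c ↦ μ {c * f ≤ 1}` is the mass of the band
between the two thresholds. -/
theorem measureReal_mul_le_one_sub {α : Type*} [MeasurableSpace α] (μ : Measure α)
    [IsFiniteMeasure μ] {f : α → ℝ} (hf : Measurable f) (hfnn : ∀ z, 0 ≤ f z) {c c' : ℝ}
    (hcc : c ≤ c') :
    μ.real {z | c * f z ≤ 1} - μ.real {z | c' * f z ≤ 1} =
      μ.real {z | c * f z ≤ 1 ∧ 1 < c' * f z} := by
  have hsub : {z | c' * f z ≤ 1} ⊆ {z | c * f z ≤ 1} := fun z hz =>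
    (mul_le_mul_of_nonneg_right hcc (hfnn z)).trans hz
  rw [← measureReal_sdiff hsub (measurableSet_le (hf.const_mul c') measurable_const)]
  congr 1
  ext z
  simp

theorem stmt6
    {Ω : Type*} [MeasurableSpace Ω]
    (P Q : Measure Ω) [IsProbabilityMeasure P] [IsProbabilityMeasure Q]
    (Z : Ω → ℝ) (hZmeas : Measurable Z) (hZpos : ∀ᵐ ω ∂P, 0 < Z ω)
    (hQ : Q = P.withDensity (fun ω => ENNReal.ofReal (Z ω)))
    (H : Ω → ℝ) (hHmeas : Measurable H) (hHnn : ∀ ω, 0 ≤ H ω)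
    (d : ℕ) (hd : 1 ≤ d) (W : Ω → (Fin d → ℝ)) (hW : Measurable W)
    (f : (Fin d → ℝ) → ℝ) (hf : Measurable f) (hfnn : ∀ z, 0 ≤ f z)
    (hZH : ∀ᵐ ω ∂P, Z ω * H ω = f (W ω))
    (hac1 : Measure.map W P ≪ (volume : Measure (Fin d → ℝ)))
    (hac2 : (volume : Measure (Fin d → ℝ)) ≪ Measure.map W P)
 :
    StrictAntiOn (fun c : ℝ => (P {ω | c * H ω ≤ (Z ω)⁻¹}).toReal) (Set.Ici 0) ↔ (∀ a b : ℝ, 0 < a → a < b → 0 < volume {z | a < f z ∧ f z ≤ b}) := by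
  have := Measure.isProbabilityMeasure_map (μ := P) hW.aemeasurable
  have hΨ (c : ℝ) : (P {ω | c * H ω ≤ (Z ω)⁻¹}).toReal =
      (Measure.map W P).real {z | c * f z ≤ 1} := by
    rw [Measure.real, Measure.map_apply hW (measurableSet_le (hf.const_mul c) measurable_const)]
    congr 1
    apply measure_congr
    filter_upwards [hZpos, hZH] with ω hZ hω
    apply propext
    change c * H ω ≤ (Z ω)⁻¹ ↔ c * f (W ω) ≤ 1
    rw [← hω, ← one_div, le_div_iff₀ hZ, mul_right_comm, mul_assoc]
  have hlt {c c' : ℝ} (hcc : c < c') :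
      (P {ω | c' * H ω ≤ (Z ω)⁻¹}).toReal < (P {ω | c * H ω ≤ (Z ω)⁻¹}).toReal ↔
        0 < volume {z | c * f z ≤ 1 ∧ 1 < c' * f z} := by
    rw [hΨ, hΨ, ← sub_pos, measureReal_mul_le_one_sub _ hf hfnn hcc.le, Measure.real,
      ENNReal.toReal_pos_iff, and_iff_left (measure_lt_top _ _), pos_iff_ne_zero, pos_iff_ne_zero]
    exact not_congr ⟨fun h => hac2 h, fun h => hac1 h⟩
  constructor
  · intro h a b ha hab
    have hb := ha.trans hab
    have hcc : b⁻¹ < a⁻¹ := inv_strictAnti₀ ha hab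
    refine ((hlt hcc).1 (h (inv_pos.2 hb).le (inv_pos.2 ha).le hcc)).trans_le (measure_mono ?_)
    rintro z ⟨h1, h2⟩
    exact ⟨by simpa using (lt_inv_mul_iff₀ ha).1 h2, by simpa using (inv_mul_le_iff₀ hb).1 h1⟩
  · intro h c hc c' _ hcc
    have hc0 : 0 ≤ c := hc
    have hc' : 0 < c' := hc0.trans_lt hcc
    refine (hlt hcc).2 ?_
    rcases hc0.eq_or_lt with rfl | hcpos
    · refine (h c'⁻¹ (c'⁻¹ + 1) (inv_pos.2 hc') (lt_add_one _)).trans_le (measure_mono ?_)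
      rintro z ⟨h1, -⟩
      exact ⟨by simp, (inv_lt_iff_one_lt_mul₀' hc').1 h1⟩
    · refine (h c'⁻¹ c⁻¹ (inv_pos.2 hc') (inv_strictAnti₀ hcpos hcc)).trans_le (measure_mono ?_)
      rintro z ⟨h1, h2⟩
      refine ⟨?_, (inv_lt_iff_one_lt_mul₀' hc').1 h1⟩
      rwa [← one_div, le_div_iff₀' hcpos] at h2
end

section
/- Assume Z·H = f∘W a.s., where the law of W under Q is equivalent to d-dimensional Lebesgue measure λ_d. Then the function Ψ₂(c) = e^{−rT}·∫_{A_c} H dQ, where A_c = {Z⁻¹ ≥ c·H}, is continuous on [0, ∞) if and only if condition (C1) holds, i.e. if and only if λ_d({z : f(z) = c}) = 0 for every c > 0. -/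
open MeasureTheory Filter Topology Set

/-- Truncated integrals `∫_{c X ≤ 1} H` converge to `∫_s H` along a filter as soon as, almost
everywhere, the condition `c X ≤ 1` is eventually equivalent to membership in `s`. -/
lemma tendsto_setIntegral_mul_le_one {Ω : Type*} [MeasurableSpace Ω] {μ : Measure Ω}
    {X H : Ω → ℝ} (hX : Measurable X) (hH : Integrable H μ) {l : Filter ℝ}
    [l.IsCountablyGenerated] {s : Set Ω} (hs : MeasurableSet s)
    (h : ∀ᵐ ω ∂μ, ∀ᶠ c in l, (c * X ω ≤ 1 ↔ ω ∈ s)) :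
    Tendsto (fun c : ℝ => ∫ ω in {ω | c * X ω ≤ 1}, H ω ∂μ) l (𝓝 (∫ ω in s, H ω ∂μ)) := by
  have hm (c : ℝ) : MeasurableSet {ω | c * X ω ≤ 1} :=
    measurableSet_le (hX.const_mul c) measurable_const
  simp_rw [← integral_indicator hs, ← integral_indicator (hm _)]
  refine tendsto_integral_filter_of_dominated_convergence (fun ω => ‖H ω‖)
    (.of_forall fun c => (hH.indicator (hm c)).aestronglyMeasurable)
    (.of_forall fun c => .of_forall fun ω => norm_indicator_le_norm_self _ _) hH.norm ?_
  filter_upwards [h] with ω hω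
  refine tendsto_const_nhds.congr' ?_
  filter_upwards [hω] with c hc
  have hc' : ω ∈ {ω | c * X ω ≤ 1} ↔ ω ∈ s := hc
  by_cases h' : ω ∈ s
  · rw [indicator_of_mem h', indicator_of_mem (hc'.2 h')]
  · rw [indicator_of_notMem h', indicator_of_notMem (mt hc'.1 h')]

/-- For a nonnegative integrable `H` and a nonnegative `X` with `H ≠ 0` wherever `X > 0`,
continuity of `c ↦ ∫_{c X ≤ 1} H` on `[0, ∞)` means that `X` has no positive atoms. -/
lemma continuousOn_setIntegral_mul_le_one_iff {Ω : Type*} [MeasurableSpace Ω] {μ : Measure Ω}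
    {X H : Ω → ℝ} (hX : Measurable X) (hH : Integrable H μ) (hH0 : ∀ ω, 0 ≤ H ω)
    (hXH : ∀ᵐ ω ∂μ, 0 < X ω → H ω ≠ 0) (hX0 : ∀ ω, 0 ≤ X ω) :
    ContinuousOn (fun c : ℝ => ∫ ω in {ω | c * X ω ≤ 1}, H ω ∂μ) (Ici 0) ↔
      ∀ c : ℝ, 0 < c → μ {ω | X ω = c} = 0 := by
  constructor
  · intro hcont c hc
    have hc' : 0 < c⁻¹ := inv_pos.2 hc
    have hlt : MeasurableSet {ω | c⁻¹ * X ω < 1} :=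
      measurableSet_lt (hX.const_mul _) measurable_const
    have heq : MeasurableSet {ω | X ω = c} := measurableSet_eq_fun hX measurable_const
    have hlim := tendsto_setIntegral_mul_le_one hX hH (l := 𝓝[>] c⁻¹) hlt <| by
      refine .of_forall fun ω => ?_
      rcases lt_or_ge (c⁻¹ * X ω) 1 with h | h
      · have hev : ∀ᶠ a in 𝓝 c⁻¹, a * X ω < 1 :=
          (continuous_id.mul continuous_const).continuousAt.eventually_lt
            continuousAt_const h
        filter_upwards [nhdsWithin_le_nhds hev] with a ha
        exact ⟨fun _ => h, fun _ => ha.le⟩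
      · filter_upwards [self_mem_nhdsWithin] with a ha
        have hXpos : 0 < X ω := by
          refine (hX0 ω).lt_of_ne fun h0 => ?_
          rw [← h0, mul_zero] at h
          linarith
        have : c⁻¹ * X ω < a * X ω := mul_lt_mul_of_pos_right ha hXpos
        exact ⟨fun h' => by linarith, fun h' => absurd h' h.not_gt⟩
    have hlim' := (hcont c⁻¹ hc'.le).mono_left
      (nhdsWithin_mono _ fun a (ha : c⁻¹ < a) => hc'.le.trans ha.le)
    have hint := tendsto_nhds_unique hlim hlim'
    have hunion : {ω | c⁻¹ * X ω ≤ 1} = {ω | c⁻¹ * X ω < 1} ∪ {ω | X ω = c} := by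
      ext ω
      simp only [mem_ofPred_eq, mem_union, le_iff_lt_or_eq, inv_mul_eq_one₀ hc.ne', eq_comm]
    have hdisj : Disjoint {ω | c⁻¹ * X ω < 1} {ω | X ω = c} := by
      refine Set.disjoint_left.2 fun ω h1 h2 => ?_
      rw [mem_ofPred_eq] at h1 h2
      rw [h2, inv_mul_cancel₀ hc.ne'] at h1
      exact lt_irrefl _ h1
    have hzero : ∫ ω in {ω | X ω = c}, H ω ∂μ = 0 := by
      simp only [hunion] at hint
      rw [setIntegral_union hdisj heq hH.integrableOn hH.integrableOn] at hint
      linarith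
    rw [setIntegral_eq_zero_iff_of_nonneg_ae (.of_forall hH0) hH.integrableOn,
      Filter.EventuallyEq, ae_restrict_iff' heq] at hzero
    refine measure_eq_zero_iff_ae_notMem.2 ?_
    filter_upwards [hzero, hXH] with ω h1 h2 (h3 : X ω = c)
    exact h2 (h3 ▸ hc) (h1 h3)
  · intro hatom c hc
    have hle : MeasurableSet {ω | c * X ω ≤ 1} :=
      measurableSet_le (hX.const_mul _) measurable_const
    have hne : ∀ᵐ ω ∂μ, c * X ω ≠ 1 := by
      rcases (mem_Ici.1 hc).eq_or_lt with rfl | hc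
      · simp
      · filter_upwards [measure_eq_zero_iff_ae_notMem.1 (hatom c⁻¹ (inv_pos.2 hc))] with ω h h'
        exact h (eq_inv_of_mul_eq_one_right h')
    refine (tendsto_setIntegral_mul_le_one hX hH hle ?_).mono_left nhdsWithin_le_nhds
    filter_upwards [hne] with ω hω
    have hcont : ContinuousAt (fun a : ℝ => a * X ω) c :=
      (continuous_id.mul continuous_const).continuousAt
    rcases hω.lt_or_gt with h | h
    · filter_upwards [hcont.eventually_lt continuousAt_const h] with a ha
      exact ⟨fun _ => h.le, fun _ => ha.le⟩
    · filter_upwards [continuousAt_const.eventually_lt hcont h] with a ha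
      exact ⟨fun h' => absurd h' ha.not_ge, fun h' => absurd h' h.not_ge⟩

theorem stmt9
    {Ω : Type*} [MeasurableSpace Ω]
    (P Q : Measure Ω) [IsProbabilityMeasure P] [IsProbabilityMeasure Q]
    (Z : Ω → ℝ) (hZmeas : Measurable Z) (hZpos : ∀ᵐ ω ∂P, 0 < Z ω)
    (hQ : Q = P.withDensity (fun ω => ENNReal.ofReal (Z ω)))
    (H : Ω → ℝ) (hHmeas : Measurable H) (hHnn : ∀ ω, 0 ≤ H ω)
    (hHint : Integrable H Q)
    (r T : ℝ) (hT : 0 < T)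
    (d : ℕ) (hd : 1 ≤ d) (W : Ω → (Fin d → ℝ)) (hW : Measurable W)
    (f : (Fin d → ℝ) → ℝ) (hf : Measurable f) (hfnn : ∀ z, 0 ≤ f z)
    (hZH : ∀ᵐ ω ∂Q, Z ω * H ω = f (W ω))
    (hac1 : Measure.map W Q ≪ (volume : Measure (Fin d → ℝ)))
    (hac2 : (volume : Measure (Fin d → ℝ)) ≪ Measure.map W Q)
 :
    ContinuousOn (fun c : ℝ => Real.exp (-(r*T)) * ∫ ω in {ω | c * H ω ≤ (Z ω)⁻¹}, H ω ∂Q) (Set.Ici 0) ↔ (∀ c : ℝ, 0 < c → volume {z | f z = c} = 0) := by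
  have hZQ : ∀ᵐ ω ∂Q, 0 < Z ω :=
    (hQ ▸ withDensity_absolutelyContinuous P _ : Q ≪ P).ae_le hZpos
  have hψ (c : ℝ) : ∫ ω in {ω | c * H ω ≤ (Z ω)⁻¹}, H ω ∂Q
      = ∫ ω in {ω | c * f (W ω) ≤ 1}, H ω ∂Q := by
    refine setIntegral_congr_set ?_
    filter_upwards [hZQ, hZH] with ω h1 h2
    refine propext ?_
    change c * H ω ≤ (Z ω)⁻¹ ↔ c * f (W ω) ≤ 1
    rw [← h2, ← one_div, le_div_iff₀ h1, mul_assoc, mul_comm (H ω)]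
  have hpos : ∀ᵐ ω ∂Q, 0 < f (W ω) → H ω ≠ 0 := by
    filter_upwards [hZH] with ω h1 h2 h3
    rw [← h1, h3, mul_zero] at h2
    exact lt_irrefl _ h2
  simp_rw [hψ]
  have hscale (g : ℝ → ℝ) :
      ContinuousOn (fun c => Real.exp (-(r * T)) * g c) (Ici 0) ↔ ContinuousOn g (Ici 0) := by
    refine ⟨fun h => ?_, fun h => continuousOn_const.mul h⟩
    refine ((continuousOn_const (c := Real.exp (r * T))).mul h).congr fun c _ => ?_
    simp [← mul_assoc, ← Real.exp_add]
  refine (hscale _).trans <| (continuousOn_setIntegral_mul_le_one_iff (hf.comp hW) hHint hHnn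
    hpos fun ω => hfnn (W ω)).trans ?_
  refine forall₂_congr fun c _ => ?_
  have hmap : Measure.map W Q {z | f z = c} = Q {ω | f (W ω) = c} :=
    Measure.map_apply hW (measurableSet_eq_fun hf measurable_const)
  exact ⟨fun h => hac2 (hmap.trans h), fun h => hmap.symm.trans (hac1 h)⟩
end

section
/- Assume Z·H = f∘W a.s., where the law of W under Q is equivalent to d-dimensional Lebesgue measure λ_d. Then the function Ψ₂(c) = e^{−rT}·∫_{A_c} H dQ, where A_c = {Z⁻¹ ≥ c·H}, is strictly decreasing on [0, ∞) if and only if condition (C2) holds, i.e. if and only if λ_d({z : a < f(z) ≤ b}) > 0 for all 0 < a < b. -/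
open MeasureTheory Filter Topology Set

theorem setIntegral_lt_setIntegral_iff_measure_diff_pos {Ω : Type*} [MeasurableSpace Ω]
    {μ : Measure Ω} {g : Ω → ℝ} {A B : Set Ω} (hB : MeasurableSet B)
    (hBA : B ⊆ A) (hg : Integrable g μ) (hg0 : ∀ ω, 0 ≤ g ω) (hpos : ∀ᵐ ω ∂μ, ω ∉ B → 0 < g ω) :
    ∫ ω in B, g ω ∂μ < ∫ ω in A, g ω ∂μ ↔ 0 < μ (A \ B) := by
  have h1 : (Function.support g ∩ (A \ B) : Set Ω) =ᵐ[μ] (A \ B : Set Ω) := by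
    refine eventuallyEq_set.2 ?_
    filter_upwards [hpos] with ω hω
    exact ⟨fun h => h.2, fun h => ⟨(hω h.2).ne', h⟩⟩
  rw [← sub_pos, ← setIntegral_sdiff hB hg.integrableOn hBA,
    setIntegral_pos_iff_support_of_nonneg_ae (Eventually.of_forall hg0) hg.integrableOn,
    measure_congr h1]

theorem mul_le_inv_iff_mul_mul_le_one {c h z : ℝ} (hz : 0 < z) :
    c * h ≤ z⁻¹ ↔ c * (z * h) ≤ 1 := by
  rw [← one_div, le_div_iff₀ hz]
  ring_nf

theorem stmt10
    {Ω : Type*} [MeasurableSpace Ω]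
    (P Q : Measure Ω) [IsProbabilityMeasure P] [IsProbabilityMeasure Q]
    (Z : Ω → ℝ) (hZmeas : Measurable Z) (hZpos : ∀ᵐ ω ∂P, 0 < Z ω)
    (hQ : Q = P.withDensity (fun ω => ENNReal.ofReal (Z ω)))
    (H : Ω → ℝ) (hHmeas : Measurable H) (hHnn : ∀ ω, 0 ≤ H ω)
    (hHint : Integrable H Q)
    (r T : ℝ) (hT : 0 < T)
    (d : ℕ) (hd : 1 ≤ d) (W : Ω → (Fin d → ℝ)) (hW : Measurable W)
    (f : (Fin d → ℝ) → ℝ) (hf : Measurable f) (hfnn : ∀ z, 0 ≤ f z)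
    (hZH : ∀ᵐ ω ∂Q, Z ω * H ω = f (W ω))
    (hac1 : Measure.map W Q ≪ (volume : Measure (Fin d → ℝ)))
    (hac2 : (volume : Measure (Fin d → ℝ)) ≪ Measure.map W Q)
 :
    StrictAntiOn (fun c : ℝ => Real.exp (-(r*T)) * ∫ ω in {ω | c * H ω ≤ (Z ω)⁻¹}, H ω ∂Q) (Set.Ici 0) ↔ (∀ a b : ℝ, 0 < a → a < b → 0 < volume {z | a < f z ∧ f z ≤ b}) := by
  have hZQ : ∀ᵐ ω ∂Q, 0 < Z ω := by
    rw [hQ]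
    exact (withDensity_absolutelyContinuous P _).ae_le hZpos
  have key : ∀ c₁ c₂ : ℝ, 0 ≤ c₁ → c₁ < c₂ →
      (Real.exp (-(r*T)) * ∫ ω in {ω | c₂ * H ω ≤ (Z ω)⁻¹}, H ω ∂Q <
        Real.exp (-(r*T)) * ∫ ω in {ω | c₁ * H ω ≤ (Z ω)⁻¹}, H ω ∂Q ↔
      0 < volume {z | c₁ * f z ≤ 1 ∧ 1 < c₂ * f z}) := by
    intro c₁ c₂ h₁ h₁₂
    have hA : ∀ c : ℝ, MeasurableSet {ω | c * H ω ≤ (Z ω)⁻¹} := fun c =>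
      measurableSet_le (hHmeas.const_mul c) hZmeas.inv
    have hS : MeasurableSet {z | c₁ * f z ≤ 1 ∧ 1 < c₂ * f z} :=
      (measurableSet_le (hf.const_mul c₁) measurable_const).inter
        (measurableSet_lt measurable_const (hf.const_mul c₂))
    have hpos : ∀ᵐ ω ∂Q, ω ∉ {ω | c₂ * H ω ≤ (Z ω)⁻¹} → 0 < H ω := by
      filter_upwards [hZQ] with ω hz hω
      refine (hHnn ω).lt_of_ne fun h => hω ?_
      simpa [← h] using hz.le
    have hsub : {ω | c₂ * H ω ≤ (Z ω)⁻¹} ⊆ {ω | c₁ * H ω ≤ (Z ω)⁻¹} := fun ω hω =>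
      (mul_le_mul_of_nonneg_right h₁₂.le (hHnn ω)).trans hω
    rw [mul_lt_mul_iff_right₀ (Real.exp_pos _),
      setIntegral_lt_setIntegral_iff_measure_diff_pos (hA c₂) hsub hHint hHnn hpos]
    have hset : ({ω | c₁ * H ω ≤ (Z ω)⁻¹} \ {ω | c₂ * H ω ≤ (Z ω)⁻¹} : Set Ω) =ᵐ[Q]
        W ⁻¹' {z | c₁ * f z ≤ 1 ∧ 1 < c₂ * f z} := by
      refine eventuallyEq_set.2 ?_
      filter_upwards [hZQ, hZH] with ω hz hω
      simp only [Set.mem_sdiff, mem_ofPred_eq, mem_preimage,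
        mul_le_inv_iff_mul_mul_le_one hz, hω, not_le]
    rw [measure_congr hset, ← Measure.map_apply hW hS, pos_iff_ne_zero, pos_iff_ne_zero]
    exact not_congr ⟨fun h => hac2 h, fun h => hac1 h⟩
  constructor
  · intro h a b ha hab
    have hb := ha.trans hab
    have hlt : b⁻¹ < a⁻¹ := inv_strictAnti₀ ha hab
    refine ((key b⁻¹ a⁻¹ (inv_pos.2 hb).le hlt).1
      (h (inv_pos.2 hb).le (inv_pos.2 ha).le hlt)).trans_le (measure_mono ?_)
    rintro z ⟨h₁, h₂⟩
    rw [inv_mul_le_iff₀ hb, mul_one] at h₁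
    rw [lt_inv_mul_iff₀ ha, mul_one] at h₂
    exact ⟨h₂, h₁⟩
  · intro h c₁ hc₁ c₂ _ h₁₂
    have hc₁' : 0 ≤ c₁ := hc₁
    have hc₂ : 0 < c₂ := hc₁'.trans_lt h₁₂
    refine (key c₁ c₂ hc₁' h₁₂).2 ?_
    obtain ⟨b, hab, hb⟩ : ∃ b, c₂⁻¹ < b ∧ c₁ * b ≤ 1 := by
      rcases hc₁'.eq_or_lt with h0 | h0
      · exact ⟨c₂⁻¹ + 1, by linarith, by simp [← h0]⟩
      · exact ⟨c₁⁻¹, inv_strictAnti₀ h0 h₁₂, (mul_inv_cancel₀ h0.ne').le⟩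
    refine (h c₂⁻¹ b (inv_pos.2 hc₂) hab).trans_le (measure_mono ?_)
    rintro z ⟨h₁, h₂⟩
    exact ⟨(mul_le_mul_of_nonneg_left h₂ hc₁').trans hb, (inv_lt_iff_one_lt_mul₀' hc₂).1 h₁⟩
end

section
/- Assume Z·H = f∘W a.s., where the law of W under P is equivalent to d-dimensional Lebesgue measure λ_d, and assume condition (C1) holds. Then for every y in the interval (P({H = 0}), 1] there exists c ∈ [0, ∞) such that Ψ₁(c) = y; in particular, for every α ∈ [0, P({H ≠ 0})) the equation Ψ₁(c) = 1 − α has a solution c ∈ [0, ∞). -/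
open MeasureTheory Filter Topology Set

/-- If `c₀ * H ≠ V` almost surely, then `c ↦ μ {c * H ≤ V}` is continuous at `c₀`. -/
theorem continuousAt_measure_mul_le {Ω : Type*} [MeasurableSpace Ω] {μ : Measure Ω}
    [IsFiniteMeasure μ] {H V : Ω → ℝ} (hH : Measurable H) (hV : Measurable V) {c₀ : ℝ}
    (hne : ∀ᵐ ω ∂μ, c₀ * H ω ≠ V ω) :
    ContinuousAt (fun c : ℝ => (μ {ω | c * H ω ≤ V ω}).toReal) c₀ := by
  refine (ENNReal.tendsto_toReal (measure_ne_top μ _)).comp ?_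
  refine tendsto_measure_of_ae_tendsto_indicator_of_isFiniteMeasure (𝓝 c₀)
    (measurableSet_le (hH.const_mul _) hV) (fun c => measurableSet_le (hH.const_mul c) hV) ?_
  filter_upwards [hne] with ω hω
  have hcont : ContinuousAt (fun c : ℝ => c * H ω) c₀ := by fun_prop
  rcases hω.lt_or_gt with h | h
  · filter_upwards [hcont.eventually_lt_const h] with c hc
    exact iff_of_true hc.le h.le
  · filter_upwards [hcont.eventually_const_lt h] with c hc
    exact iff_of_false hc.not_ge h.not_ge

/-- If `H ≥ 0` and `V > 0` almost surely, then `μ {c * H ≤ V}` tends to `μ {H = 0}` as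
`c → ∞`. -/
theorem tendsto_measure_mul_le_atTop {Ω : Type*} [MeasurableSpace Ω] {μ : Measure Ω}
    [IsFiniteMeasure μ] {H V : Ω → ℝ} (hH : Measurable H) (hV : Measurable V)
    (hH0 : ∀ᵐ ω ∂μ, 0 ≤ H ω) (hV0 : ∀ᵐ ω ∂μ, 0 < V ω) :
    Tendsto (fun c : ℝ => (μ {ω | c * H ω ≤ V ω}).toReal) atTop
      (𝓝 (μ {ω | H ω = 0}).toReal) := by
  refine (ENNReal.tendsto_toReal (measure_ne_top μ _)).comp ?_
  refine tendsto_measure_of_ae_tendsto_indicator_of_isFiniteMeasure atTop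
    (hH (measurableSet_singleton 0)) (fun c => measurableSet_le (hH.const_mul c) hV) ?_
  filter_upwards [hH0, hV0] with ω h0 hpos
  rcases h0.eq_or_lt with h | h
  · exact .of_forall fun c => iff_of_true (by simp [← h, hpos.le]) h.symm
  · filter_upwards [(tendsto_id.atTop_mul_const h).eventually_gt_atTop (V ω)] with c hc
    exact iff_of_false (not_le.mpr hc) h.ne'

theorem stmt11
    {Ω : Type*} [MeasurableSpace Ω]
    (P Q : Measure Ω) [IsProbabilityMeasure P] [IsProbabilityMeasure Q]
    (Z : Ω → ℝ) (hZmeas : Measurable Z) (hZpos : ∀ᵐ ω ∂P, 0 < Z ω)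
    (hQ : Q = P.withDensity (fun ω => ENNReal.ofReal (Z ω)))
    (H : Ω → ℝ) (hHmeas : Measurable H) (hHnn : ∀ ω, 0 ≤ H ω)
    (d : ℕ) (hd : 1 ≤ d) (W : Ω → (Fin d → ℝ)) (hW : Measurable W)
    (f : (Fin d → ℝ) → ℝ) (hf : Measurable f) (hfnn : ∀ z, 0 ≤ f z)
    (hZH : ∀ᵐ ω ∂P, Z ω * H ω = f (W ω))
    (hac1 : Measure.map W P ≪ (volume : Measure (Fin d → ℝ)))
    (hac2 : (volume : Measure (Fin d → ℝ)) ≪ Measure.map W P)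
    (hC1 : (∀ c : ℝ, 0 < c → volume {z | f z = c} = 0)) :
    (∀ y : ℝ, (P {ω | H ω = 0}).toReal < y → y ≤ 1 →
      ∃ c : ℝ, 0 ≤ c ∧ (fun c : ℝ => (P {ω | c * H ω ≤ (Z ω)⁻¹}).toReal) c = y) ∧
    (∀ α : ℝ, 0 ≤ α → α < (P {ω | H ω ≠ 0}).toReal →
      ∃ c : ℝ, 0 ≤ c ∧ (fun c : ℝ => (P {ω | c * H ω ≤ (Z ω)⁻¹}).toReal) c = 1 - α) := by
  have hV : Measurable fun ω => (Z ω)⁻¹ := hZmeas.inv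
  have hVpos : ∀ᵐ ω ∂P, 0 < (Z ω)⁻¹ := hZpos.mono fun ω h => inv_pos.mpr h
  have hne : ∀ c : ℝ, 0 ≤ c → ∀ᵐ ω ∂P, c * H ω ≠ (Z ω)⁻¹ := by
    intro c hc
    rcases hc.eq_or_lt with rfl | hc
    · filter_upwards [hVpos] with ω h
      simpa using h.ne
    · have hlevel : ∀ᵐ z ∂(Measure.map W P), f z ≠ c⁻¹ := by
        refine hac1.ae_le (ae_iff.mpr ?_)
        simpa using hC1 c⁻¹ (inv_pos.mpr hc)
      filter_upwards [ae_of_ae_map hW.aemeasurable hlevel, hZH, hZpos] with ω h1 h2 h3 h4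
      apply h1
      rw [← h2]
      apply eq_inv_of_mul_eq_one_left
      rw [mul_assoc, mul_comm (H ω), h4, mul_inv_cancel₀ h3.ne']
  have hzero : (P {ω | 0 * H ω ≤ (Z ω)⁻¹}).toReal = 1 := by
    have h : P {ω | 0 * H ω ≤ (Z ω)⁻¹} = 1 := by
      refine (measure_congr (eventuallyEq_univ.mpr ?_)).trans measure_univ
      filter_upwards [hVpos] with ω h
      simpa using h.le
    simp only [h, ENNReal.toReal_one]
  have hlim := tendsto_measure_mul_le_atTop hHmeas hV (.of_forall hHnn) hVpos
  have hsurj : ∀ y : ℝ, (P {ω | H ω = 0}).toReal < y → y ≤ 1 →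
      ∃ c : ℝ, 0 ≤ c ∧ (P {ω | c * H ω ≤ (Z ω)⁻¹}).toReal = y := by
    intro y hy hy1
    obtain ⟨b, hb, hb0⟩ := ((hlim.eventually_lt_const hy).and (eventually_ge_atTop 0)).exists
    obtain ⟨c, hc, hcy⟩ := intermediate_value_Icc' hb0
      (fun c hc => (continuousAt_measure_mul_le hHmeas hV (hne c hc.1)).continuousWithinAt)
      ⟨hb.le, hy1.trans hzero.ge⟩
    exact ⟨c, hc.1, hcy⟩
  refine ⟨hsurj, fun α hα hα1 => hsurj (1 - α) ?_ (by linarith)⟩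
  have hcompl : P.real {ω | H ω = 0}ᶜ = 1 - P.real {ω | H ω = 0} :=
    probReal_compl_eq_one_sub (hHmeas (measurableSet_singleton 0))
  have : α < P.real {ω | H ω = 0}ᶜ := hα1
  change P.real {ω | H ω = 0} < 1 - α
  linarith
end

section
/- Assume Z·H = f∘W a.s., where the law of W under Q is equivalent to d-dimensional Lebesgue measure λ_d, assume ∫ H dQ > 0, and assume condition (C1) holds. Then for every x in the interval (0, e^{−rT}·∫ H dQ] there exists c ∈ [0, ∞) such that Ψ₂(c) = x. -/
open MeasureTheory Filter Topology Set

theorem stmt12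
    {Ω : Type*} [MeasurableSpace Ω]
    (P Q : Measure Ω) [IsProbabilityMeasure P] [IsProbabilityMeasure Q]
    (Z : Ω → ℝ) (hZmeas : Measurable Z) (hZpos : ∀ᵐ ω ∂P, 0 < Z ω)
    (hQ : Q = P.withDensity (fun ω => ENNReal.ofReal (Z ω)))
    (H : Ω → ℝ) (hHmeas : Measurable H) (hHnn : ∀ ω, 0 ≤ H ω)
    (hHint : Integrable H Q)
    (r T : ℝ) (hT : 0 < T)
    (d : ℕ) (hd : 1 ≤ d) (W : Ω → (Fin d → ℝ)) (hW : Measurable W)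
    (f : (Fin d → ℝ) → ℝ) (hf : Measurable f) (hfnn : ∀ z, 0 ≤ f z)
    (hZH : ∀ᵐ ω ∂Q, Z ω * H ω = f (W ω))
    (hac1 : Measure.map W Q ≪ (volume : Measure (Fin d → ℝ)))
    (hac2 : (volume : Measure (Fin d → ℝ)) ≪ Measure.map W Q)
    (hpos : 0 < ∫ ω, H ω ∂Q)
    (hC1 : (∀ c : ℝ, 0 < c → volume {z | f z = c} = 0)) :
    ∀ x : ℝ, 0 < x → x ≤ Real.exp (-(r*T)) * ∫ ω, H ω ∂Q →
      ∃ c : ℝ, 0 ≤ c ∧ (fun c : ℝ => Real.exp (-(r*T)) * ∫ ω in {ω | c * H ω ≤ (Z ω)⁻¹}, H ω ∂Q) c = x := by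
  have hsm : ∀ c : ℝ, MeasurableSet {ω | c * H ω ≤ (Z ω)⁻¹} := fun c =>
    measurableSet_le (hHmeas.const_mul c) hZmeas.inv
  have hZposQ : ∀ᵐ ω ∂Q, 0 < Z ω := by
    have hac : Q ≪ P := hQ ▸ withDensity_absolutelyContinuous _ _
    exact hac.ae_le hZpos
  have hlevel : ∀ c : ℝ, ∀ᵐ ω ∂Q, c * H ω ≠ (Z ω)⁻¹ := by
    intro c
    have hfW : ∀ᵐ ω ∂Q, c * f (W ω) ≠ 1 := by
      rcases le_or_gt c 0 with hc | hc
      · filter_upwards with ω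
        have := mul_nonpos_of_nonpos_of_nonneg hc (hfnn (W ω))
        linarith
      · have hnull : ∀ᵐ z ∂(Measure.map W Q), f z ≠ c⁻¹ := by
          have hvol : ∀ᵐ z, f z ≠ c⁻¹ := by
            rw [ae_iff]
            simpa using hC1 c⁻¹ (inv_pos.mpr hc)
          exact hac1.ae_le hvol
        filter_upwards [ae_of_ae_map hW.aemeasurable hnull] with ω hω h
        exact hω (eq_inv_of_mul_eq_one_right h)
    filter_upwards [hfW, hZH, hZposQ] with ω h1 h2 h3 h
    apply h1
    rw [← h2, mul_left_comm, h, mul_inv_cancel₀ h3.ne']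
  have hbound : ∀ c : ℝ, ∀ᵐ ω ∂Q,
      ‖indicator {ω | c * H ω ≤ (Z ω)⁻¹} H ω‖ ≤ H ω := fun c => by
    filter_upwards with ω
    exact (norm_indicator_le_norm_self H ω).trans_eq (Real.norm_of_nonneg (hHnn ω))
  have hmeas : ∀ c : ℝ, AEStronglyMeasurable (indicator {ω | c * H ω ≤ (Z ω)⁻¹} H) Q :=
    fun c => (hHmeas.indicator (hsm c)).aestronglyMeasurable
  set G : ℝ → ℝ := fun c => ∫ ω, indicator {ω | c * H ω ≤ (Z ω)⁻¹} H ω ∂Q with hG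
  have hGset : ∀ c, ∫ ω in {ω | c * H ω ≤ (Z ω)⁻¹}, H ω ∂Q = G c := fun c =>
    (integral_indicator (hsm c)).symm
  have hcont : Continuous G := by
    rw [continuous_iff_continuousAt]
    intro c
    refine tendsto_integral_filter_of_dominated_convergence H (Eventually.of_forall hmeas)
      (Eventually.of_forall hbound) hHint ?_
    filter_upwards [hlevel c] with ω hω
    have hlin : ContinuousAt (fun b : ℝ => b * H ω) c := by fun_prop
    apply tendsto_const_nhds.congr'
    rcases lt_or_gt_of_ne hω with h | h
    · filter_upwards [hlin.eventually_lt_const h] with b hb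
      rw [indicator_of_mem (show ω ∈ {ω | c * H ω ≤ (Z ω)⁻¹} from h.le),
        indicator_of_mem (show ω ∈ {ω | b * H ω ≤ (Z ω)⁻¹} from hb.le)]
    · filter_upwards [hlin.eventually_const_lt h] with b hb
      rw [indicator_of_notMem (show ω ∉ {ω | c * H ω ≤ (Z ω)⁻¹} from h.not_ge),
        indicator_of_notMem (show ω ∉ {ω | b * H ω ≤ (Z ω)⁻¹} from hb.not_ge)]
  have hlim : Tendsto G atTop (𝓝 0) := by
    rw [← integral_zero Ω ℝ (μ := Q)]
    refine tendsto_integral_filter_of_dominated_convergence H (Eventually.of_forall hmeas)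
      (Eventually.of_forall hbound) hHint ?_
    filter_upwards with ω
    apply tendsto_const_nhds.congr'
    rcases (hHnn ω).eq_or_lt with h | h
    · filter_upwards with b
      simp [indicator, ← h]
    · filter_upwards [(tendsto_id.atTop_mul_const h).eventually_gt_atTop (Z ω)⁻¹] with b hb
      exact (indicator_of_notMem (show ω ∉ {ω | b * H ω ≤ (Z ω)⁻¹} from hb.not_ge) H).symm
  have hG0 : G 0 = ∫ ω, H ω ∂Q := by
    apply integral_congr_ae
    filter_upwards [hZposQ] with ω hω
    have hmem : ω ∈ {ω | 0 * H ω ≤ (Z ω)⁻¹} := by simpa using hω.le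
    exact indicator_of_mem hmem H
  intro x hx0 hx
  have hE := Real.exp_pos (-(r * T))
  have hy : 0 < x / Real.exp (-(r * T)) := div_pos hx0 hE
  obtain ⟨b, hb, hb0⟩ := ((hlim.eventually_lt_const hy).and (eventually_ge_atTop 0)).exists
  obtain ⟨c, hc, hGc⟩ := intermediate_value_Icc' hb0 hcont.continuousOn
    ⟨hb.le, by rw [hG0, div_le_iff₀' hE]; exact hx⟩
  refine ⟨c, hc.1, ?_⟩
  simp only [hGset]
  rw [hGc, mul_div_cancel₀ _ hE.ne']
end

section
/- Assume Z·H = f∘W a.s., where the law of W under P is equivalent to d-dimensional Lebesgue measure λ_d, and assume both conditions (C1) and (C2) hold. Then for every y in the interval (P({H = 0}), 1] there exists a UNIQUE c ∈ [0, ∞) such that Ψ₁(c) = y. -/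
open MeasureTheory Filter Topology Set

/-- If no positive level set of a nonnegative `f` is charged by `μ`, then `c ↦ μ {c * f ≤ 1}` is
continuous. -/
lemma continuous_measureReal_mul_le_one {α : Type*} [MeasurableSpace α] (μ : Measure α)
    [IsProbabilityMeasure μ] (f : α → ℝ) (hf : Measurable f) (hfnn : ∀ z, 0 ≤ f z)
    (h : ∀ c : ℝ, 0 < c → μ {z | f z = c} = 0) :
    Continuous fun c : ℝ => μ.real {z | c * f z ≤ 1} := by
  have hm : ∀ c : ℝ, MeasurableSet {z | c * f z ≤ 1} := fun c =>
    measurableSet_le (hf.const_mul c) measurable_const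
  refine continuous_iff_continuousAt.2 fun c => ?_
  refine (ENNReal.tendsto_toReal (measure_ne_top _ _)).comp ?_
  refine tendsto_measure_of_ae_tendsto_indicator_of_isFiniteMeasure (𝓝 c) (hm c) hm ?_
  have hne : ∀ᵐ z ∂μ, c * f z ≠ 1 := by
    rcases le_or_gt c 0 with hc | hc
    · exact ae_of_all _ fun z => by nlinarith [mul_nonneg (neg_nonneg.2 hc) (hfnn z)]
    · refine measure_mono_null (fun z hz => ?_) (h c⁻¹ (inv_pos.2 hc))
      have hz' : c * f z = 1 := by simpa using hz
      exact eq_inv_of_mul_eq_one_right hz'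
  filter_upwards [hne] with z hz
  have hcont : Tendsto (fun a : ℝ => a * f z) (𝓝 c) (𝓝 (c * f z)) :=
    (continuous_mul_const (f z)).tendsto c
  rcases lt_or_gt_of_ne hz with hlt | hgt
  · filter_upwards [hcont.eventually_lt_const hlt] with a ha
    simp [ha.le, hlt.le]
  · filter_upwards [hcont.eventually_const_lt hgt] with a ha
    exact iff_of_false ha.not_ge hgt.not_ge

lemma tendsto_measureReal_mul_le_one_atTop {α : Type*} [MeasurableSpace α] (μ : Measure α)
    [IsProbabilityMeasure μ] (f : α → ℝ) (hf : Measurable f) (hfnn : ∀ z, 0 ≤ f z) :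
    Tendsto (fun c : ℝ => μ.real {z | c * f z ≤ 1}) atTop (𝓝 (μ.real {z | f z = 0})) := by
  refine (ENNReal.tendsto_toReal (measure_ne_top _ _)).comp ?_
  refine tendsto_measure_of_ae_tendsto_indicator_of_isFiniteMeasure atTop
    (hf (measurableSet_singleton 0))
    (fun c => measurableSet_le (hf.const_mul c) measurable_const) (ae_of_all _ fun z => ?_)
  rcases (hfnn z).eq_or_lt with h0 | hpos
  · exact Eventually.of_forall fun c => by simp [← h0]
  · filter_upwards [eventually_gt_atTop (f z)⁻¹] with c hc
    have : 1 < c * f z := by rwa [← div_lt_iff₀ hpos, one_div]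
    simp [this, hpos.ne']

/-- If `μ` charges every `{a < f ≤ b}` with `0 < a < b`, then `c ↦ μ {c * f ≤ 1}` is strictly
decreasing on `[0, ∞)`. -/
lemma strictAntiOn_measureReal_mul_le_one {α : Type*} [MeasurableSpace α] (μ : Measure α)
    [IsProbabilityMeasure μ] (f : α → ℝ) (hf : Measurable f) (hfnn : ∀ z, 0 ≤ f z)
    (h : ∀ a b : ℝ, 0 < a → a < b → 0 < μ {z | a < f z ∧ f z ≤ b}) :
    StrictAntiOn (fun c : ℝ => μ.real {z | c * f z ≤ 1}) (Ici 0) := by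
  intro a ha b _ hab
  have ha : 0 ≤ a := ha
  have hb : 0 < b := ha.trans_lt hab
  obtain ⟨t, hbt, hat⟩ : ∃ t : ℝ, b⁻¹ < t ∧ a * t ≤ 1 := by
    rcases ha.eq_or_lt with h0 | hpos
    · exact ⟨b⁻¹ + 1, by linarith, by simp [← h0]⟩
    · exact ⟨a⁻¹, inv_strictAnti₀ hpos hab, by rw [mul_inv_cancel₀ hpos.ne']⟩
  have hs : 0 < μ.real {z | b⁻¹ < f z ∧ f z ≤ t} :=
    ENNReal.toReal_pos (h _ _ (inv_pos.2 hb) hbt).ne' (measure_ne_top _ _)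
  have hm : MeasurableSet {z | b⁻¹ < f z ∧ f z ≤ t} :=
    (measurableSet_lt measurable_const hf).inter (measurableSet_le hf measurable_const)
  have hdisj : Disjoint {z | b * f z ≤ 1} {z | b⁻¹ < f z ∧ f z ≤ t} := by
    refine Set.disjoint_left.2 fun z hz hz' => ?_
    have h1 : b * f z ≤ 1 := hz
    have h2 := mul_lt_mul_of_pos_left hz'.1 hb
    rw [mul_inv_cancel₀ hb.ne'] at h2
    linarith
  have hsub : {z | b * f z ≤ 1} ∪ {z | b⁻¹ < f z ∧ f z ≤ t} ⊆ {z | a * f z ≤ 1} := by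
    rintro z (hz | hz)
    · exact (mul_le_mul_of_nonneg_right hab.le (hfnn z)).trans hz
    · exact (mul_le_mul_of_nonneg_left hz.2 ha).trans hat
  have hle := measureReal_mono (μ := μ) hsub
  rw [measureReal_union hdisj hm] at hle
  simp only
  linarith


theorem stmt13
    {Ω : Type*} [MeasurableSpace Ω]
    (P Q : Measure Ω) [IsProbabilityMeasure P] [IsProbabilityMeasure Q]
    (Z : Ω → ℝ) (hZmeas : Measurable Z) (hZpos : ∀ᵐ ω ∂P, 0 < Z ω)
    (hQ : Q = P.withDensity (fun ω => ENNReal.ofReal (Z ω)))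
    (H : Ω → ℝ) (hHmeas : Measurable H) (hHnn : ∀ ω, 0 ≤ H ω)
    (d : ℕ) (hd : 1 ≤ d) (W : Ω → (Fin d → ℝ)) (hW : Measurable W)
    (f : (Fin d → ℝ) → ℝ) (hf : Measurable f) (hfnn : ∀ z, 0 ≤ f z)
    (hZH : ∀ᵐ ω ∂P, Z ω * H ω = f (W ω))
    (hac1 : Measure.map W P ≪ (volume : Measure (Fin d → ℝ)))
    (hac2 : (volume : Measure (Fin d → ℝ)) ≪ Measure.map W P)
    (hC1 : (∀ c : ℝ, 0 < c → volume {z | f z = c} = 0)) (hC2 : (∀ a b : ℝ, 0 < a → a < b → 0 < volume {z | a < f z ∧ f z ≤ b})) :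
    ∀ y : ℝ, (P {ω | H ω = 0}).toReal < y → y ≤ 1 →
      ∃! c : ℝ, 0 ≤ c ∧ (fun c : ℝ => (P {ω | c * H ω ≤ (Z ω)⁻¹}).toReal) c = y := by
  have := Measure.isProbabilityMeasure_map (μ := P) hW.aemeasurable
  set μ : Measure (Fin d → ℝ) := P.map W
  have hΨ : ∀ c : ℝ, (P {ω | c * H ω ≤ (Z ω)⁻¹}).toReal = μ.real {z | c * f z ≤ 1} := by
    intro c
    rw [map_measureReal_apply hW (measurableSet_le (hf.const_mul c) measurable_const),
      measureReal_def]
    congr 1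
    refine measure_congr ?_
    filter_upwards [hZpos, hZH] with ω hz hzh
    refine propext ?_
    change c * H ω ≤ (Z ω)⁻¹ ↔ c * f (W ω) ≤ 1
    rw [← hzh, ← one_div, le_div_iff₀ hz, mul_assoc, mul_comm (H ω)]
  have hzero : (P {ω | H ω = 0}).toReal = μ.real {z | f z = 0} := by
    have hm : MeasurableSet {z | f z = 0} := hf (measurableSet_singleton 0)
    rw [map_measureReal_apply hW hm, measureReal_def]
    congr 1
    refine measure_congr ?_
    filter_upwards [hZpos, hZH] with ω hz hzh
    refine propext ?_
    change H ω = 0 ↔ f (W ω) = 0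
    simp [← hzh, hz.ne']
  intro y hy hy1
  simp only [hΨ]
  rw [hzero] at hy
  have hcont := continuous_measureReal_mul_le_one μ f hf hfnn fun c hc => hac1 (hC1 c hc)
  have hanti := strictAntiOn_measureReal_mul_le_one μ f hf hfnn fun a b ha hab =>
    pos_iff_ne_zero.2 fun h0 => (hC2 a b ha hab).ne' (hac2 h0)
  obtain ⟨M, hMy, hM⟩ := (((tendsto_measureReal_mul_le_one_atTop μ f hf hfnn).eventually_lt_const
    hy).and (eventually_ge_atTop 0)).exists
  have hone : μ.real {z | (0 : ℝ) * f z ≤ 1} = 1 := by simp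
  obtain ⟨c, hc, hcy⟩ := intermediate_value_Icc' hM hcont.continuousOn ⟨hMy.le, hy1.trans hone.ge⟩
  exact ⟨c, ⟨hc.1, hcy⟩, fun c' hc' => hanti.injOn hc'.1 hc.1 (hc'.2.trans hcy.symm)⟩
end

section
/- Assume Z·H = f∘W a.s., where the law of W under Q is equivalent to d-dimensional Lebesgue measure λ_d, assume ∫ H dQ > 0, and assume both conditions (C1) and (C2) hold. Then for every x in the interval (0, e^{−rT}·∫ H dQ] there exists a UNIQUE c ∈ [0, ∞) such that Ψ₂(c) = x. -/
open MeasureTheory Filter Topology Set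

section LevelSets

variable {Ω : Type*} [MeasurableSpace Ω] {μ : Measure Ω} {g H : Ω → ℝ}

theorem continuous_setIntegral_mul_le_one (hg : Measurable g) (hH : Integrable H μ)
    (hlevel : ∀ c : ℝ, 0 < c → ∀ᵐ ω ∂μ, g ω ≠ c) (hgnn : ∀ ω, 0 ≤ g ω) :
    Continuous fun c : ℝ => ∫ ω in {ω | c * g ω ≤ 1}, H ω ∂μ := by
  have hmeas (c : ℝ) : MeasurableSet {ω | c * g ω ≤ 1} :=
    measurableSet_le (hg.const_mul c) measurable_const
  simp_rw [fun c => (integral_indicator (μ := μ) (f := H) (hmeas c)).symm]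
  refine continuous_iff_continuousAt.2 fun c₀ => ?_
  have hne : ∀ᵐ ω ∂μ, c₀ * g ω ≠ 1 := by
    rcases le_or_gt c₀ 0 with h | h
    · exact ae_of_all _ fun ω hω => by
        linarith [mul_nonpos_of_nonpos_of_nonneg h (hgnn ω)]
    · filter_upwards [hlevel c₀⁻¹ (inv_pos.2 h)] with ω hω h1
      exact hω (eq_inv_of_mul_eq_one_right h1)
  refine tendsto_integral_filter_of_dominated_convergence (fun ω => ‖H ω‖)
    (Eventually.of_forall fun c => (hH.indicator (hmeas c)).aestronglyMeasurable)
    (Eventually.of_forall fun c => ae_of_all _ fun ω => norm_indicator_le_norm_self _ _)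
    hH.norm ?_
  filter_upwards [hne] with ω hω
  have hcont : Tendsto (fun c : ℝ => c * g ω) (𝓝 c₀) (𝓝 (c₀ * g ω)) :=
    tendsto_id.mul_const _
  refine tendsto_const_nhds.congr' ?_
  rcases lt_or_gt_of_ne hω with h | h
  · filter_upwards [hcont.eventually_lt_const h] with c hc
    simp [indicator, h.le, hc.le]
  · filter_upwards [hcont.eventually_const_lt h] with c hc
    simp [indicator, h.not_ge, hc.not_ge]

theorem tendsto_setIntegral_mul_le_one_atTop (hg : Measurable g) (hH : Integrable H μ)
    (hgnn : ∀ ω, 0 ≤ g ω) (hzero : ∀ᵐ ω ∂μ, g ω = 0 → H ω = 0) :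
    Tendsto (fun c : ℝ => ∫ ω in {ω | c * g ω ≤ 1}, H ω ∂μ) atTop (𝓝 0) := by
  have hmeas (c : ℝ) : MeasurableSet {ω | c * g ω ≤ 1} :=
    measurableSet_le (hg.const_mul c) measurable_const
  simp_rw [fun c => (integral_indicator (μ := μ) (f := H) (hmeas c)).symm]
  rw [← integral_zero Ω ℝ (μ := μ)]
  refine tendsto_integral_filter_of_dominated_convergence (fun ω => ‖H ω‖)
    (Eventually.of_forall fun c => (hH.indicator (hmeas c)).aestronglyMeasurable)
    (Eventually.of_forall fun c => ae_of_all _ fun ω => norm_indicator_le_norm_self _ _)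
    hH.norm ?_
  filter_upwards [hzero] with ω hω
  refine tendsto_const_nhds.congr' ?_
  rcases (hgnn ω).eq_or_lt with h | h
  · exact Eventually.of_forall fun c => by simp [indicator, hω h.symm]
  · filter_upwards [(tendsto_id.atTop_mul_const h).eventually_gt_atTop 1] with c hc
    simp only [id_eq] at hc
    simp [indicator, hc.not_ge]

theorem strictAntiOn_setIntegral_mul_le_one (hg : Measurable g) (hH : Integrable H μ)
    (hHnn : ∀ ω, 0 ≤ H ω) (hgnn : ∀ ω, 0 ≤ g ω)
    (hzero : ∀ᵐ ω ∂μ, H ω = 0 → g ω = 0)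
    (hband : ∀ a b : ℝ, 0 < a → a < b → 0 < μ {ω | a < g ω ∧ g ω ≤ b}) :
    StrictAntiOn (fun c : ℝ => ∫ ω in {ω | c * g ω ≤ 1}, H ω ∂μ) (Ici 0) := by
  have hmeas (c : ℝ) : MeasurableSet {ω | c * g ω ≤ 1} :=
    measurableSet_le (hg.const_mul c) measurable_const
  intro c₁ hc₁ c₂ _ hlt
  have hc₁ : 0 ≤ c₁ := hc₁
  have hc₂ : 0 < c₂ := hc₁.trans_lt hlt
  have hsub : {ω | c₂ * g ω ≤ 1} ⊆ {ω | c₁ * g ω ≤ 1} := fun ω hω =>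
    (mul_le_mul_of_nonneg_right hlt.le (hgnn ω)).trans hω
  have hdiff := setIntegral_sdiff (μ := μ) (hmeas c₂) hH.integrableOn hsub
  have hpos : 0 < ∫ ω in {ω | c₁ * g ω ≤ 1} \ {ω | c₂ * g ω ≤ 1}, H ω ∂μ := by
    rw [setIntegral_pos_iff_support_of_nonneg_ae (ae_of_all _ hHnn) hH.integrableOn]
    have hab : 1 / c₂ < 2 / (c₁ + c₂) := by
      rw [div_lt_div_iff₀ hc₂ (by linarith)]; linarith
    refine (hband (1 / c₂) (2 / (c₁ + c₂)) (by positivity) hab).trans_le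
      (measure_mono_ae ?_)
    filter_upwards [hzero] with ω hω hmem
    obtain ⟨h₁, h₂⟩ := hmem
    have hgpos : 0 < g ω := lt_trans (by positivity) h₁
    rw [div_lt_iff₀ hc₂] at h₁
    rw [le_div_iff₀ (by linarith)] at h₂
    refine ⟨fun h => hgpos.ne' (hω h), ?_, fun h => ?_⟩
    · change c₁ * g ω ≤ 1
      nlinarith
    · have h : c₂ * g ω ≤ 1 := h
      linarith
  simp only
  linarith

end LevelSets

theorem stmt14
    {Ω : Type*} [MeasurableSpace Ω]
    (P Q : Measure Ω) [IsProbabilityMeasure P] [IsProbabilityMeasure Q]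
    (Z : Ω → ℝ) (hZmeas : Measurable Z) (hZpos : ∀ᵐ ω ∂P, 0 < Z ω)
    (hQ : Q = P.withDensity (fun ω => ENNReal.ofReal (Z ω)))
    (H : Ω → ℝ) (hHmeas : Measurable H) (hHnn : ∀ ω, 0 ≤ H ω)
    (hHint : Integrable H Q)
    (r T : ℝ) (hT : 0 < T)
    (d : ℕ) (hd : 1 ≤ d) (W : Ω → (Fin d → ℝ)) (hW : Measurable W)
    (f : (Fin d → ℝ) → ℝ) (hf : Measurable f) (hfnn : ∀ z, 0 ≤ f z)
    (hZH : ∀ᵐ ω ∂Q, Z ω * H ω = f (W ω))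
    (hac1 : Measure.map W Q ≪ (volume : Measure (Fin d → ℝ)))
    (hac2 : (volume : Measure (Fin d → ℝ)) ≪ Measure.map W Q)
    (hpos : 0 < ∫ ω, H ω ∂Q)
    (hC1 : (∀ c : ℝ, 0 < c → volume {z | f z = c} = 0)) (hC2 : (∀ a b : ℝ, 0 < a → a < b → 0 < volume {z | a < f z ∧ f z ≤ b})) :
    ∀ x : ℝ, 0 < x → x ≤ Real.exp (-(r*T)) * ∫ ω, H ω ∂Q →
      ∃! c : ℝ, 0 ≤ c ∧ (fun c : ℝ => Real.exp (-(r*T)) * ∫ ω in {ω | c * H ω ≤ (Z ω)⁻¹}, H ω ∂Q) c = x := by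
  have hQP : Q ≪ P := hQ ▸ withDensity_absolutelyContinuous _ _
  have hZQ : ∀ᵐ ω ∂Q, 0 < Z ω := hQP.ae_le hZpos
  have hg : Measurable fun ω => f (W ω) := hf.comp hW
  have hgnn (ω : Ω) : 0 ≤ f (W ω) := hfnn _
  have hiff : ∀ᵐ ω ∂Q, f (W ω) = 0 ↔ H ω = 0 := by
    filter_upwards [hZQ, hZH] with ω hz h
    rw [← h, mul_eq_zero, or_iff_right hz.ne']
  have hset (c : ℝ) : ∫ ω in {ω | c * H ω ≤ (Z ω)⁻¹}, H ω ∂Q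
      = ∫ ω in {ω | c * f (W ω) ≤ 1}, H ω ∂Q := by
    refine setIntegral_congr_set ?_
    filter_upwards [hZQ, hZH] with ω hz h
    refine propext ?_
    change c * H ω ≤ (Z ω)⁻¹ ↔ c * f (W ω) ≤ 1
    rw [← h, ← one_div, le_div_iff₀ hz, mul_assoc, mul_comm (H ω)]
  have hcont := continuous_setIntegral_mul_le_one hg hHint (fun c hc => by
    have h : Q.map W (f ⁻¹' {c}) = 0 := hac1 (hC1 c hc)
    rw [Measure.map_apply hW (hf (measurableSet_singleton c))] at h
    exact measure_eq_zero_iff_ae_notMem.1 h) hgnn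
  have hlim := tendsto_setIntegral_mul_le_one_atTop hg hHint hgnn
    (hiff.mono fun _ h => h.1)
  have hanti := strictAntiOn_setIntegral_mul_le_one hg hHint hHnn hgnn
    (hiff.mono fun _ h => h.2) (fun a b ha hab => by
      have h : Q.map W (f ⁻¹' Ioc a b) ≠ 0 := fun h =>
        (hC2 a b ha hab).ne' (hac2 h)
      rw [Measure.map_apply hW (hf measurableSet_Ioc)] at h
      exact pos_iff_ne_zero.2 h)
  intro x hx hxle
  have hE := Real.exp_pos (-(r * T))
  set E := Real.exp (-(r * T))
  simp only [hset]
  obtain ⟨M, hM, hM0⟩ := ((hlim.eventually_lt_const (div_pos hx hE)).and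
    (eventually_ge_atTop 0)).exists
  obtain ⟨c, hc, hcx⟩ := intermediate_value_Icc' hM0 hcont.continuousOn
    (show x / E ∈ _ from ⟨hM.le, by
      rw [div_le_iff₀' hE]; simpa using hxle⟩)
  simp only at hcx
  refine ⟨c, ⟨hc.1, by simp only [hcx]; field_simp⟩, fun y hy => ?_⟩
  refine hanti.injOn hy.1 hc.1 ?_
  simp only [hcx]
  rw [eq_div_iff hE.ne', mul_comm]
  exact hy.2
end

section
/- Let a, b, K > 0 and let p, q be real numbers with p < q and q > 0, and define g(x) = a·e^{p·x} − b·e^{q·x}. Then the equation g(x) = −K has a unique solution x₀ ∈ ℝ, and {x ∈ ℝ : g(x) ≥ −K} = (−∞, x₀]. -/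
open MeasureTheory Filter Topology Set

lemma strictAnti_mul_exp_neg {c r : ℝ} (hc : 0 < c) (hr : r < 0) :
    StrictAnti fun x : ℝ => c * Real.exp (r * x) := fun _ _ hxy =>
  mul_lt_mul_of_pos_left (Real.exp_lt_exp.2 (mul_lt_mul_of_neg_left hxy hr)) hc

lemma tendsto_mul_exp_neg_atTop (c : ℝ) {r : ℝ} (hr : r < 0) :
    Tendsto (fun x : ℝ => c * Real.exp (r * x)) atTop (𝓝 0) := by
  simpa using (Real.tendsto_exp_atBot.comp (tendsto_id.const_mul_atTop_of_neg hr)).const_mul c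

lemma tendsto_mul_exp_neg_atBot {c r : ℝ} (hc : 0 < c) (hr : r < 0) :
    Tendsto (fun x : ℝ => c * Real.exp (r * x)) atBot atTop :=
  (Real.tendsto_exp_atTop.comp (tendsto_id.const_mul_atBot_of_neg hr)).const_mul_atTop hc

lemma exists_sum_exp_neg_eq {a b K r s : ℝ} (ha : 0 < a) (hb : 0 < b) (hK : 0 < K)
    (hr : r < 0) (hs : s < 0) :
    ∃ x : ℝ, a * Real.exp (r * x) + K * Real.exp (s * x) = b := by
  have htop : Tendsto (fun x : ℝ => a * Real.exp (r * x) + K * Real.exp (s * x)) atTop (𝓝 0) := by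
    simpa using (tendsto_mul_exp_neg_atTop a hr).add (tendsto_mul_exp_neg_atTop K hs)
  have hbot : Tendsto (fun x : ℝ => a * Real.exp (r * x) + K * Real.exp (s * x)) atBot atTop :=
    (tendsto_mul_exp_neg_atBot ha hr).atTop_add_atTop (tendsto_mul_exp_neg_atBot hK hs)
  obtain ⟨u, hu⟩ := (htop.eventually_le_const hb).exists
  obtain ⟨v, hv⟩ := (hbot.eventually_ge_atTop b).exists
  exact mem_range_of_exists_le_of_exists_ge (by fun_prop) ⟨u, hu⟩ ⟨v, hv⟩

theorem stmt18
    (a b K p q : ℝ) (ha : 0 < a) (hb : 0 < b) (hK : 0 < K)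
    (hq : 0 < q) (hpq : p < q)
    (g : ℝ → ℝ) (hg : g = fun x => a * Real.exp (p * x) - b * Real.exp (q * x)) :
    ∃ x₀ : ℝ, g x₀ = -K ∧ (∀ x : ℝ, g x = -K → x = x₀) ∧
      {x : ℝ | g x ≥ -K} = Set.Iic x₀ := by
  have hr : p - q < 0 := sub_neg.2 hpq
  have hs : -q < 0 := neg_neg_of_pos hq
  obtain ⟨x₀, hx₀⟩ := exists_sum_exp_neg_eq ha hb hK hr hs
  set F : ℝ → ℝ := fun x => a * Real.exp ((p - q) * x) + K * Real.exp (-q * x) with hF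
  have hanti : StrictAnti F := (strictAnti_mul_exp_neg ha hr).add (strictAnti_mul_exp_neg hK hs)
  have hF₀ : F x₀ = b := hx₀
  have hfactor (x : ℝ) : g x + K = Real.exp (q * x) * (F x - F x₀) := by
    have h₁ : Real.exp (p * x) = Real.exp (q * x) * Real.exp ((p - q) * x) := by
      rw [← Real.exp_add]; ring_nf
    have h₂ : Real.exp (q * x) * Real.exp (-q * x) = 1 := by
      rw [← Real.exp_add]; simp
    rw [hF₀, hg]
    simp only [hF]
    linear_combination a * h₁ - K * h₂
  refine ⟨x₀, ?_, fun x hx => ?_, ?_⟩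
  · linarith [hfactor x₀, mul_eq_zero_of_right (Real.exp (q * x₀)) (sub_self (F x₀))]
  · have h : Real.exp (q * x) * (F x - F x₀) = 0 := by rw [← hfactor, hx, neg_add_cancel]
    exact hanti.injective (sub_eq_zero.1 ((mul_eq_zero.1 h).resolve_left (Real.exp_ne_zero _)))
  · ext x
    rw [mem_ofPred_eq, mem_Iic, ge_iff_le, neg_le_iff_add_nonneg, hfactor,
      mul_nonneg_iff_of_pos_left (Real.exp_pos _), sub_nonneg, hanti.le_iff_ge]
end
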